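/- Explicit formula for Kerov polynomials (Proposition 2.1): let A be a commutative ℚ-algebra, R_2, R_3, … ∈ A, L(ζ) = ζ + Σ_{j≥2} R_j ζ^{1-j}, H the compositional inverse of L, and Σ_k := -(1/k) [z^{-1}] H(z) H(z-1) ⋯ H(z-k+1). Set F(ζ) := 1/L'(ζ) = 1/(1 - Σ_{k≥2} (k-1) R_k ζ^{-k}). Then for every integer k ≥ 1: Σ_k = -(1/k) · [ζ^{-1}] ( (1/F(ζ)) · ∏_{j=0}^{k-1} ( ζ + Σ_{r≥1} ((-j)^r / r!) (F(ζ) d/dζ)^{r-1}[F(ζ)] ) ). -/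

import Mathlib

noncomputable section

variable {A : Type*}

/-- The formal derivative `d/dz` of a formal series at infinity. A series at infinity
`f(z) = Σ_{n ≤ N} a_n z^n` is modeled as a `LaurentSeries` in the variable `w = 1/z`,
so that the coefficient of `z^n` is `f.coeff (-n)`; the derivative satisfies
`(derivZ f).coeff m = (1 - m) • f.coeff (m - 1)`. -/
noncomputable def derivZ [CommRing A] (f : LaurentSeries A) : LaurentSeries A where
  coeff m := (1 - m) • f.coeff (m - 1)
  isPWO_support' := by
    refine (f.isPWO_support.image_of_monotone (f := fun n => n + 1)
      (fun a b hab => by simpa using hab)).mono ?_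
    intro m hm
    have hf : f.coeff (m - 1) ≠ 0 := by
      intro h
      simp [Function.mem_support, h] at hm
    exact ⟨m - 1, by simpa [HahnSeries.mem_support] using hf, by ring⟩

/-- `IsSumOf g F` asserts that the formal series at infinity `g` is the coefficientwise
convergent sum `Σ_{r ≥ 0} F r`: for each coefficient, the partial sums eventually stabilize. -/
def IsSumOf [CommRing A] (g : LaurentSeries A) (F : ℕ → LaurentSeries A) : Prop :=
  ∀ m : ℤ, ∃ N : ℕ, ∀ n : ℕ, N ≤ n → g.coeff m = (∑ r ∈ Finset.range n, F r).coeff m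

section SeriesAtInfinity

open Finset HahnSeries

variable [CommRing A]

@[simp]
theorem derivZ_coeff (f : LaurentSeries A) (m : ℤ) :
    (derivZ f).coeff m = (1 - m) • f.coeff (m - 1) := rfl

theorem derivZ_coeff_one (f : LaurentSeries A) : (derivZ f).coeff 1 = 0 := by simp

/-- The Euler operator `w d/dw` on Laurent series in `w`. -/
def eulerOp (f : LaurentSeries A) : LaurentSeries A where
  coeff m := m • f.coeff m
  isPWO_support' := f.isPWO_support.mono fun m hm h => hm (by simp [h])

theorem support_eulerOp_subset (f : LaurentSeries A) : (eulerOp f).support ⊆ f.support :=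
  fun m hm h => hm (by simp [eulerOp, h])

theorem eulerOp_mul (f g : LaurentSeries A) :
    eulerOp (f * g) = f * eulerOp g + g * eulerOp f := by
  ext m
  rw [mul_comm g, coeff_add, coeff_mul_left' f.isPWO_support (support_eulerOp_subset f),
    coeff_mul_right' g.isPWO_support (support_eulerOp_subset g), ← sum_add_distrib]
  change m • (f * g).coeff m = _
  rw [coeff_mul, smul_sum]
  refine sum_congr rfl fun ij hij => ?_
  obtain rfl : ij.1 + ij.2 = m := (mem_antidiagonal.1 hij).2.2
  simp only [eulerOp, zsmul_eq_mul]
  push_cast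
  ring

theorem derivZ_eq_single_mul (f : LaurentSeries A) :
    derivZ f = single 1 (-1) * eulerOp f := by
  ext m
  simp [coeff_single_mul, eulerOp]
  ring

theorem derivZ_mul (f g : LaurentSeries A) :
    derivZ (f * g) = f * derivZ g + g * derivZ f := by
  simp only [derivZ_eq_single_mul, eulerOp_mul]
  ring

theorem derivZ_single_neg_one : derivZ (single (-1) 1 : LaurentSeries A) = 1 := by
  ext m
  rw [derivZ_coeff, coeff_single, coeff_one]
  by_cases h : m = 0
  · simp [h]
  · rw [if_neg (by omega), if_neg h, smul_zero]

/-- `derivZ` as an additive map. -/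
def derivZHom : LaurentSeries A →+ LaurentSeries A :=
  AddMonoidHom.mk' derivZ fun f g => by ext m; simp

@[simp]
theorem derivZHom_apply (f : LaurentSeries A) : derivZHom f = derivZ f := rfl

theorem derivZ_one : derivZ (1 : LaurentSeries A) = 0 := by
  simpa using derivZ_mul (1 : LaurentSeries A) 1

theorem derivZ_pow_succ (u : LaurentSeries A) (s : ℕ) :
    derivZ (u ^ (s + 1)) = (s + 1) • (u ^ s * derivZ u) := by
  induction s with
  | zero => simp
  | succ s ih =>
    rw [pow_succ, derivZ_mul, ih]
    simp only [nsmul_eq_mul]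
    push_cast
    ring

theorem iterate_derivZ_add (s : ℕ) (f g : LaurentSeries A) :
    derivZ^[s] (f + g) = derivZ^[s] f + derivZ^[s] g :=
  iterate_map_add derivZHom s f g

theorem iterate_derivZ_mul (n : ℕ) (f g : LaurentSeries A) :
    derivZ^[n] (f * g) =
      ∑ ij ∈ antidiagonal n, n.choose ij.1 • (derivZ^[ij.1] f * derivZ^[ij.2] g) := by
  induction n with
  | zero => simp
  | succ n ih =>
    rw [sum_antidiagonal_choose_succ_nsmul (fun i j => derivZ^[i] f * derivZ^[j] g) n,
      Function.iterate_succ_apply', ih, ← derivZHom_apply, map_sum, ← sum_add_distrib]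
    refine sum_congr rfl fun ij hij => ?_
    rw [n.choose_symm_of_eq_add (mem_antidiagonal.1 hij).symm, map_nsmul, ← smul_add,
      derivZHom_apply, derivZ_mul, Function.iterate_succ_apply',
      Function.iterate_succ_apply', mul_comm (derivZ^[ij.2] g)]

theorem IsSumOf.unique {g g' : LaurentSeries A} {F : ℕ → LaurentSeries A}
    (h : IsSumOf g F) (h' : IsSumOf g' F) : g = g' := by
  ext m
  obtain ⟨N, hN⟩ := h m
  obtain ⟨N', hN'⟩ := h' m
  rw [hN _ (le_max_left N N'), hN' _ (le_max_right N N')]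

theorem IsSumOf.add {g g' : LaurentSeries A} {F F' : ℕ → LaurentSeries A}
    (h : IsSumOf g F) (h' : IsSumOf g' F') : IsSumOf (g + g') fun r => F r + F' r := by
  intro m
  obtain ⟨N, hN⟩ := h m
  obtain ⟨N', hN'⟩ := h' m
  refine ⟨max N N', fun n hn => ?_⟩
  rw [sum_add_distrib, coeff_add, coeff_add, hN n (by omega), hN' n (by omega)]

variable [Algebra ℚ A]

variable (A) in
/-- The series at infinity that are `O(z^{-n})`. -/
def bigO (n : ℤ) : Submodule ℚ (LaurentSeries A) where
  carrier := {f | ∀ m < n, f.coeff m = 0}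
  add_mem' hf hg m hm := by simp [hf m hm, hg m hm]
  zero_mem' m _ := by simp
  smul_mem' c f hf m hm := by simp [hf m hm]

theorem bigO_anti {m n : ℤ} (h : m ≤ n) : bigO A n ≤ bigO A m :=
  fun _ hf i hi => hf i (hi.trans_le h)

theorem exists_mem_bigO (f : LaurentSeries A) : ∃ a, f ∈ bigO A a :=
  ⟨f.order, fun _ hm => coeff_eq_zero_of_lt_order hm⟩

theorem mul_mem_bigO {a b c : ℤ} {f g : LaurentSeries A} (hf : f ∈ bigO A a)
    (hg : g ∈ bigO A b) (h : c ≤ a + b) : f * g ∈ bigO A c := by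
  intro m hm
  rw [coeff_mul]
  refine sum_eq_zero fun ij hij => ?_
  have hsum : ij.1 + ij.2 = m := (mem_antidiagonal.1 hij).2.2
  rcases lt_or_ge ij.1 a with h1 | h1
  · rw [hf _ h1, zero_mul]
  · rw [hg _ (by omega), mul_zero]

theorem one_mem_bigO : (1 : LaurentSeries A) ∈ bigO A 0 := fun m hm => by
  rw [coeff_one, if_neg hm.ne]

theorem pow_mem_bigO {u : LaurentSeries A} (hu : u ∈ bigO A 1) (s : ℕ) : u ^ s ∈ bigO A s := by
  induction s with
  | zero => simpa using one_mem_bigO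
  | succ s ih =>
    rw [pow_succ]
    exact mul_mem_bigO ih hu (by push_cast; rfl)

theorem derivZ_mem_bigO {a : ℤ} {f : LaurentSeries A} (hf : f ∈ bigO A a) :
    derivZ f ∈ bigO A (a + 1) := fun m hm => by
  rw [derivZ_coeff, hf _ (by omega), smul_zero]

theorem iterate_derivZ_mem_bigO {a : ℤ} {f : LaurentSeries A} (hf : f ∈ bigO A a) (s : ℕ) :
    derivZ^[s] f ∈ bigO A (s + a) := by
  induction s with
  | zero => simpa using hf
  | succ s ih =>
    rw [Function.iterate_succ_apply']
    exact bigO_anti (by push_cast; omega) (derivZ_mem_bigO ih)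

theorem eq_of_forall_sub_mem_bigO {x y : LaurentSeries A} (c : ℤ)
    (h : ∀ n : ℕ, x - y ∈ bigO A (n + c)) : x = y := by
  ext m
  have := h (m - c + 1).toNat m (by omega)
  rwa [coeff_sub, sub_eq_zero] at this

namespace IsSumOf

theorem sub_mem_bigO {g : LaurentSeries A} {F : ℕ → LaurentSeries A} {c : ℤ}
    (h : IsSumOf g F) (hF : ∀ r : ℕ, F r ∈ bigO A (r + c)) (n : ℕ) :
    g - ∑ r ∈ range n, F r ∈ bigO A (n + c) := by
  intro m hm
  obtain ⟨N, hN⟩ := h m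
  rw [coeff_sub, hN (max N n) (le_max_left _ _), ← coeff_sub,
    ← sum_Ico_eq_sub _ (le_max_right N n)]
  refine (Submodule.sum_mem (bigO A (n + c)) fun r hr => ?_) m hm
  exact bigO_anti (by have := (mem_Ico.1 hr).1; omega) (hF r)

theorem of_sub_mem_bigO {g : LaurentSeries A} {F : ℕ → LaurentSeries A} (c : ℤ)
    (h : ∀ n : ℕ, g - ∑ r ∈ range n, F r ∈ bigO A (n + c)) : IsSumOf g F := by
  refine fun m => ⟨(m - c + 1).toNat, fun n hn => ?_⟩
  have := h n m (by omega)
  rwa [coeff_sub, sub_eq_zero] at this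

theorem mul {g g' : LaurentSeries A} {F F' : ℕ → LaurentSeries A} {c c' : ℤ}
    (h : IsSumOf g F) (hF : ∀ r : ℕ, F r ∈ bigO A (r + c))
    (h' : IsSumOf g' F') (hF' : ∀ r : ℕ, F' r ∈ bigO A (r + c')) :
    IsSumOf (g * g') fun n => ∑ i ∈ range (n + 1), F i * F' (n - i) := by
  refine of_sub_mem_bigO (c + c') fun n => ?_
  have hg' : g' ∈ bigO A c' := by simpa using h'.sub_mem_bigO hF' 0
  have key : g * g' - ∑ k ∈ range n, ∑ i ∈ range (k + 1), F i * F' (k - i) =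
      (g - ∑ i ∈ range n, F i) * g' +
        ∑ i ∈ range n, F i * (g' - ∑ k ∈ range (n - i), F' k) := by
    rw [sum_range_diag_flip n fun i k => F i * F' k]
    simp only [mul_sub, mul_sum, sum_sub_distrib, sub_mul, sum_mul]
    ring
  rw [key]
  refine add_mem (mul_mem_bigO (h.sub_mem_bigO hF n) hg' (by omega))
    (Submodule.sum_mem _ fun i hi => ?_)
  have := mem_range.1 hi
  exact mul_mem_bigO (hF i) (h'.sub_mem_bigO hF' (n - i)) (by omega)

end IsSumOf

theorem exists_isSumOf {F : ℕ → LaurentSeries A} {c : ℤ}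
    (hF : ∀ r : ℕ, F r ∈ bigO A (r + c)) : ∃ g, IsSumOf g F := by
  have hstable : ∀ (m : ℤ) (n n' : ℕ), m < n + c → n ≤ n' →
      (∑ r ∈ range n', F r).coeff m = (∑ r ∈ range n, F r).coeff m := by
    intro m n n' hm hn
    rw [← sub_eq_zero, ← coeff_sub, ← sum_Ico_eq_sub _ hn]
    refine (Submodule.sum_mem (bigO A (n + c)) fun r hr => ?_) m hm
    exact bigO_anti (by have := (mem_Ico.1 hr).1; omega) (hF r)
  refine ⟨ofSuppBddBelow
    (fun m => (∑ r ∈ range (m - c + 1).toNat, F r).coeff m) ⟨c, fun m hm => ?_⟩, fun m =>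
    ⟨(m - c + 1).toNat, fun n hn => (hstable m _ n (by omega) hn).symm⟩⟩
  by_contra hlt
  refine hm ?_
  rw [not_le] at hlt
  simp [show (m - c + 1).toNat = 0 by omega]

/-- The `s`-th term `u^s f^{(s)} / s!` of the Taylor expansion of `f(z + u)`. -/
def taylorTerm (u : LaurentSeries A) (s : ℕ) (f : LaurentSeries A) : LaurentSeries A :=
  ((Nat.factorial s : ℚ))⁻¹ • (u ^ s * derivZ^[s] f)

theorem taylorTerm_zero (u f : LaurentSeries A) : taylorTerm u 0 f = f := by
  simp [taylorTerm]

theorem taylorTerm_mem_bigO {u f : LaurentSeries A} {a : ℤ} (hu : u ∈ bigO A 1)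
    (hf : f ∈ bigO A a) (s : ℕ) : taylorTerm u s f ∈ bigO A (s + a) :=
  Submodule.smul_mem _ _ (mul_mem_bigO (pow_mem_bigO hu s) (iterate_derivZ_mem_bigO hf s)
    (by omega))

theorem taylorTerm_mul (u f g : LaurentSeries A) (n : ℕ) :
    taylorTerm u n (f * g) =
      ∑ i ∈ range (n + 1), taylorTerm u i f * taylorTerm u (n - i) g := by
  rw [← Nat.sum_antidiagonal_eq_sum_range_succ
    (fun i j => taylorTerm u i f * taylorTerm u j g) n, taylorTerm, iterate_derivZ_mul,
    mul_sum, smul_sum]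
  refine sum_congr rfl fun ij hij => ?_
  obtain rfl := mem_antidiagonal.1 hij
  simp only [taylorTerm, smul_mul_smul_comm]
  rw [← Nat.cast_smul_eq_nsmul ℚ, mul_smul_comm, smul_smul, _root_.pow_add]
  congr 1
  · rw [Nat.cast_add_choose]
    have := Nat.cast_ne_zero (R := ℚ).2 (Nat.factorial_ne_zero (ij.1 + ij.2))
    field_simp
  · ring

theorem derivZ_inv_factorial_smul (u g : LaurentSeries A) (s : ℕ) :
    derivZ (((Nat.factorial (s + 1) : ℚ))⁻¹ • (u ^ (s + 1) * g)) =
      ((Nat.factorial (s + 1) : ℚ))⁻¹ • (u ^ (s + 1) * derivZ g) +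
        derivZ u * ((Nat.factorial s : ℚ))⁻¹ • (u ^ s * g) := by
  have hpow : derivZ (u ^ (s + 1)) = ((s + 1 : ℕ) : ℚ) • (u ^ s * derivZ u) := by
    rw [derivZ_pow_succ, Nat.cast_smul_eq_nsmul]
  rw [← derivZHom_apply, map_rat_smul, derivZHom_apply, derivZ_mul, hpow, smul_add,
    mul_smul_comm, smul_smul, mul_smul_comm]
  congr 2
  · rw [Nat.factorial_succ]
    push_cast
    have := Nat.cast_ne_zero (R := ℚ).2 (Nat.factorial_ne_zero s)
    field_simp
  · ring

/-- Composition with `z + u`, where `u = O(1/z)`, as a ring endomorphism. -/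
theorem exists_taylorHom {u : LaurentSeries A} (hu : u ∈ bigO A 1) :
    ∃ T : LaurentSeries A →+* LaurentSeries A,
      ∀ f, IsSumOf (T f) fun s => taylorTerm u s f := by
  have hex : ∀ f : LaurentSeries A, ∃ g, IsSumOf g fun s => taylorTerm u s f := fun f =>
    have ⟨_, ha⟩ := exists_mem_bigO f
    exists_isSumOf (taylorTerm_mem_bigO hu ha)
  choose T hT using hex
  have hadd : ∀ f g, T (f + g) = T f + T g := fun f g => by
    refine (hT (f + g)).unique ?_
    convert (hT f).add (hT g) using 2 with s
    simp [taylorTerm, iterate_derivZ_add, mul_add]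
  have hone : T 1 = 1 := by
    refine (hT 1).unique fun m => ⟨1, fun n hn => ?_⟩
    rw [sum_eq_single_of_mem 0 (mem_range.2 hn), taylorTerm_zero]
    intro s _ hs
    obtain ⟨s, rfl⟩ := Nat.exists_eq_succ_of_ne_zero hs
    have h0 : derivZ^[s] (0 : LaurentSeries A) = 0 := iterate_map_zero derivZHom s
    simp [taylorTerm, derivZ_one, h0]
  have hmul : ∀ f g, T (f * g) = T f * T g := fun f g => by
    obtain ⟨a, ha⟩ := exists_mem_bigO f
    obtain ⟨b, hb⟩ := exists_mem_bigO g
    refine (hT (f * g)).unique ?_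
    simpa only [taylorTerm_mul] using (hT f).mul (taylorTerm_mem_bigO hu ha) (hT g)
      (taylorTerm_mem_bigO hu hb)
  exact ⟨RingHom.mk' ⟨⟨T, hone⟩, hmul⟩ hadd, hT⟩

section TaylorHom

variable {u : LaurentSeries A} {T : LaurentSeries A →+* LaurentSeries A}

theorem taylorHom_mem_bigO (hu : u ∈ bigO A 1)
    (hT : ∀ f, IsSumOf (T f) fun s => taylorTerm u s f) {f : LaurentSeries A} {a : ℤ}
    (hf : f ∈ bigO A a) : T f ∈ bigO A a := by
  simpa using (hT f).sub_mem_bigO (taylorTerm_mem_bigO hu hf) 0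

/-- The chain rule. -/
theorem derivZ_taylorHom (hu : u ∈ bigO A 1)
    (hT : ∀ f, IsSumOf (T f) fun s => taylorTerm u s f) (f : LaurentSeries A) :
    derivZ (T f) = (1 + derivZ u) * T (derivZ f) := by
  obtain ⟨a, ha⟩ := exists_mem_bigO f
  refine eq_of_forall_sub_mem_bigO a fun n => ?_
  have hsum : derivZ (∑ s ∈ range (n + 1), taylorTerm u s f) =
      ∑ s ∈ range (n + 1), taylorTerm u s (derivZ f) +
        derivZ u * ∑ s ∈ range n, taylorTerm u s (derivZ f) := by
    rw [← derivZHom_apply, map_sum, sum_range_succ', sum_range_succ' _ n, mul_sum,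
      taylorTerm_zero, taylorTerm_zero, derivZHom_apply, add_right_comm,
      ← sum_add_distrib]
    congr 1
    refine sum_congr rfl fun s _ => ?_
    rw [derivZHom_apply, taylorTerm, derivZ_inv_factorial_smul,
      ← Function.iterate_succ_apply' derivZ, Function.iterate_succ_apply,
      Function.iterate_succ_apply]
    rfl
  have hf := derivZ_mem_bigO ((hT f).sub_mem_bigO (taylorTerm_mem_bigO hu ha) (n + 1))
  have hf' := (hT (derivZ f)).sub_mem_bigO (taylorTerm_mem_bigO hu (derivZ_mem_bigO ha))
  have key : derivZ (T f) - (1 + derivZ u) * T (derivZ f) =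
      derivZ (T f - ∑ s ∈ range (n + 1), taylorTerm u s f) -
        (T (derivZ f) - ∑ s ∈ range (n + 1), taylorTerm u s (derivZ f)) -
        derivZ u * (T (derivZ f) - ∑ s ∈ range n, taylorTerm u s (derivZ f)) := by
    rw [← derivZHom_apply (_ - _), map_sub, derivZHom_apply,
      derivZHom_apply, hsum]
    ring
  rw [key]
  exact sub_mem (sub_mem (bigO_anti (by push_cast; omega) hf)
    (bigO_anti (by push_cast; omega) (hf' (n + 1))))
    (mul_mem_bigO (derivZ_mem_bigO hu) (hf' n) (by omega))

/-- Change of variables for the residue. -/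
theorem coeff_one_mul_taylorHom (hu : u ∈ bigO A 1)
    (hT : ∀ f, IsSumOf (T f) fun s => taylorTerm u s f) (f : LaurentSeries A) :
    ((1 + derivZ u) * T f).coeff 1 = f.coeff 1 := by
  obtain ⟨a, ha⟩ := exists_mem_bigO f
  have htail := (hT f).sub_mem_bigO (taylorTerm_mem_bigO hu ha)
  let n : ℕ := (2 - a).toNat
  have hsum : ∑ s ∈ range (n + 1), taylorTerm u s f +
      derivZ u * ∑ s ∈ range n, taylorTerm u s f =
      f + derivZ (∑ s ∈ range n,
        ((Nat.factorial (s + 1) : ℚ))⁻¹ • (u ^ (s + 1) * derivZ^[s] f)) := by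
    rw [← derivZHom_apply (∑ _ ∈ _, _), map_sum, sum_range_succ', mul_sum,
      taylorTerm_zero, add_right_comm, ← sum_add_distrib, add_comm]
    congr 1
    refine sum_congr rfl fun s _ => ?_
    rw [derivZHom_apply, derivZ_inv_factorial_smul,
      ← Function.iterate_succ_apply' derivZ]
    rfl
  have key : (1 + derivZ u) * T f =
      (T f - ∑ s ∈ range (n + 1), taylorTerm u s f) +
        derivZ u * (T f - ∑ s ∈ range n, taylorTerm u s f) +
        (f + derivZ (∑ s ∈ range n,
          ((Nat.factorial (s + 1) : ℚ))⁻¹ • (u ^ (s + 1) * derivZ^[s] f))) := by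
    rw [← hsum]
    ring
  rw [key, coeff_add, coeff_add, coeff_add, derivZ_coeff_one,
    htail (n + 1) 1 (by push_cast; omega),
    mul_mem_bigO (derivZ_mem_bigO hu) (htail n) (c := 2) (by omega) 1 (by omega)]
  simp

end TaylorHom

end SeriesAtInfinity

/-- Proposition 2.1. Let `R_2, R_3, … ∈ A` (a commutative
`ℚ`-algebra), `L(ζ) = ζ + Σ_{j≥2} R_j ζ^{1-j}`, `H(z) = z - Σ_{j≥2} B_j z^{1-j}` its
compositional inverse (`H(L(ζ)) = ζ`), and
`Σ_k = -(1/k) [z^{-1}] H(z) H(z-1) ⋯ H(z-k+1)` where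
`H(z-j) = Σ_{r≥0} ((-j)^r/r!) H^{(r)}(z)`.  Let `F(ζ) = 1/L'(ζ)` (i.e. `F · L' = 1`,
with `L'(ζ) = 1 - Σ_{k≥2}(k-1) R_k ζ^{-k}`), let `Finv = 1/F(ζ)`, and let
`G j = ζ + Σ_{r≥1} ((-j)^r/r!) (F d/dζ)^{r-1}[F]` (coefficientwise convergent sum).
Then for all `k ≥ 1`:
`Σ_k = -(1/k) · [ζ^{-1}] ( (1/F(ζ)) · Π_{j=0}^{k-1} G j )`. -/
theorem kerov_explicit_formula [CommRing A] [Algebra ℚ A]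
    (B R : ℕ → A) (H L F Finv : LaurentSeries A)
    (Hshift G : ℕ → LaurentSeries A)
    (hH : ∀ m : ℤ, H.coeff m =
      if m = -1 then 1 else if 1 ≤ m then -B (m + 1).toNat else 0)
    (hL : ∀ m : ℤ, L.coeff m =
      if m = -1 then 1 else if 1 ≤ m then R (m + 1).toNat else 0)
    (hcomp : IsSumOf (HahnSeries.single (-1) 1)
      (fun s => ((Nat.factorial s : ℚ))⁻¹ •
        ((L - HahnSeries.single (-1) 1) ^ s * derivZ^[s] H)))
    (hHshift : ∀ j : ℕ, IsSumOf (Hshift j)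
      (fun r => ((-(j : ℚ)) ^ r / (Nat.factorial r : ℚ)) • derivZ^[r] H))
    (hF : F * derivZ L = 1)
    (hFinv : F * Finv = 1)
    (hG : ∀ j : ℕ, IsSumOf (G j)
      (fun r => if r = 0 then HahnSeries.single (-1) 1
        else ((-(j : ℚ)) ^ r / (Nat.factorial r : ℚ)) • (fun t => F * derivZ t)^[r - 1] F))
    (k : ℕ) (hk : 1 ≤ k) :
    -((k : ℚ))⁻¹ • (∏ j ∈ Finset.range k, Hshift j).coeff 1 =
      -((k : ℚ))⁻¹ • (Finv * ∏ j ∈ Finset.range k, G j).coeff 1 := by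
  let u : LaurentSeries A := L - HahnSeries.single (-1) 1
  have hu : u ∈ bigO A 1 := fun m hm => by
    rw [HahnSeries.coeff_sub, hL, HahnSeries.coeff_single]
    split_ifs <;> first | omega | simp
  have hHmem : H ∈ bigO A (-1) := fun m hm => by
    rw [hH, if_neg (by omega), if_neg (by omega)]
  have hLu : derivZ L = 1 + derivZ u := by
    rw [← derivZHom_apply u, map_sub, derivZHom_apply, derivZHom_apply,
      derivZ_single_neg_one]
    ring
  have hFinvL : Finv = 1 + derivZ u := by
    rw [← hLu, ← mul_one Finv, ← hF, ← mul_assoc, mul_comm Finv, hFinv, one_mul]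
  obtain ⟨T, hT⟩ := exists_taylorHom hu
  have hTH : T H = HahnSeries.single (-1) 1 := (hT H).unique hcomp
  have hTderiv : ∀ f, T (derivZ f) = F * derivZ (T f) := fun f => by
    rw [derivZ_taylorHom hu hT, ← hLu, ← mul_assoc, hF, one_mul]
  have hTiter : ∀ r, T (derivZ^[r + 1] H) = (fun t => F * derivZ t)^[r] F := fun r => by
    induction r with
    | zero => simp [hTderiv, hTH, derivZ_single_neg_one]
    | succ r ih => rw [Function.iterate_succ_apply', hTderiv, ih, Function.iterate_succ_apply']
  have hTshift : ∀ j, T (Hshift j) = G j := fun j => by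
    refine IsSumOf.unique (IsSumOf.of_sub_mem_bigO (-1) fun n => ?_) (hG j)
    have hmem := taylorHom_mem_bigO hu hT ((hHshift j).sub_mem_bigO
      (fun r => Submodule.smul_mem _ _ (iterate_derivZ_mem_bigO hHmem r)) n)
    rw [map_sub, map_sum] at hmem
    convert hmem using 4 with r
    rw [map_rat_smul]
    rcases r with _ | r
    · simp [hTH]
    · rw [if_neg r.succ_ne_zero, hTiter, Nat.add_sub_cancel]
  rw [← coeff_one_mul_taylorHom hu hT, map_prod, hFinvL]
  simp only [hTshift]
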